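/- Suppose y − x ∈ A_ε(0, r), i.e. r(1 − ε) ≤ ‖y − x‖₂ ≤ r. Then |A_ε(x, r) ∩ A_ε(y, r)| ≥ (ε/(π√3)) · |A_ε(0, r)|. -/

import Mathlib

open MeasureTheory

/-- The closed annulus centered at `x` with inner radius `r*(1-ε)` and outer radius `r`. -/
def annulus (x : EuclideanSpace ℝ (Fin 2)) (r ε : ℝ) : Set (EuclideanSpace ℝ (Fin 2)) :=
  {y | r * (1 - ε) ≤ dist y x ∧ dist y x ≤ r}

/-- The points of the coordinate plane whose distances to `(-d/2, 0)` and `(d/2, 0)` both lie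
between `q` and `r`. -/
def biannulus (r q d : ℝ) : Set (ℝ × ℝ) :=
  {p | (q ^ 2 ≤ (p.1 + d / 2) ^ 2 + p.2 ^ 2 ∧ (p.1 + d / 2) ^ 2 + p.2 ^ 2 ≤ r ^ 2) ∧
    (q ^ 2 ≤ (p.1 - d / 2) ^ 2 + p.2 ^ 2 ∧ (p.1 - d / 2) ^ 2 + p.2 ^ 2 ≤ r ^ 2)}

theorem measurableSet_biannulus (r q d : ℝ) : MeasurableSet (biannulus r q d) := by
  have h : ∀ c : ℝ, MeasurableSet
      {p : ℝ × ℝ | q ^ 2 ≤ (p.1 + c) ^ 2 + p.2 ^ 2 ∧ (p.1 + c) ^ 2 + p.2 ^ 2 ≤ r ^ 2} := fun c => by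
    rw [Set.ofPred_and]
    exact (measurableSet_le (by fun_prop) (by fun_prop)).inter
      (measurableSet_le (by fun_prop) (by fun_prop))
  simpa only [biannulus, sub_eq_add_neg, Set.ofPred_and] using
    (h (d / 2)).inter (h (-(d / 2)))

theorem integral_add_mul (c k a b : ℝ) :
    ∫ t in a..b, (c + k * t) = c * (b - a) + k * (b ^ 2 - a ^ 2) / 2 := by
  rw [intervalIntegral.integral_add (by simp) (Continuous.intervalIntegrable (by fun_prop) _ _),
    intervalIntegral.integral_const_mul]
  simp
  ring

theorem integral_sub_mul_abs (c k T : ℝ) (hT : 0 ≤ T) :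
    ∫ t in Set.Ioc (-T) T, (c - k * |t|) = 2 * c * T - k * T ^ 2 := by
  have hcont : Continuous fun t : ℝ => c - k * |t| := by fun_prop
  rw [← intervalIntegral.integral_of_le (by linarith),
    ← intervalIntegral.integral_add_adjacent_intervals (b := 0)
      (hcont.intervalIntegrable _ _) (hcont.intervalIntegrable _ _)]
  have hneg : ∫ t in (-T)..0, (c - k * |t|) = ∫ t in (-T)..0, (c + k * t) := by
    refine intervalIntegral.integral_congr fun t ht => ?_
    rw [Set.uIcc_of_le (by linarith)] at ht
    simp only [abs_of_nonpos ht.2]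
    ring
  have hpos : ∫ t in (0)..T, (c - k * |t|) = ∫ t in (0)..T, (c + -k * t) := by
    refine intervalIntegral.integral_congr fun t ht => ?_
    rw [Set.uIcc_of_le hT] at ht
    simp only [abs_of_nonneg ht.1]
    ring
  rw [hneg, hpos, integral_add_mul, integral_add_mul]
  ring

/-- If `-a ≤ b ≤ a` and `2 √a ≤ s`, then `√a - (a - b) / s` is nonnegative with square at
least `b`. -/
theorem sqrt_sub_div_bounds {a b s : ℝ} (hba : b ≤ a) (hab : 0 ≤ a + b) (hs : 0 < s)
    (has : 2 * √a ≤ s) :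
    0 ≤ √a - (a - b) / s ∧ b ≤ (√a - (a - b) / s) ^ 2 := by
  have ha : 0 ≤ a := by linarith
  have hsq := Real.sq_sqrt ha
  have h0 := Real.sqrt_nonneg a
  have hw : 0 ≤ (a - b) / s := div_nonneg (by linarith) hs.le
  have hws : (a - b) / s * s = a - b := div_mul_cancel₀ _ hs.ne'
  refine ⟨?_, by nlinarith⟩
  rw [sub_nonneg, div_le_iff₀ hs]
  nlinarith

theorem mem_biannulus_of_abs {r q d t v : ℝ} (hd : 0 ≤ d)
    (hlo : q ^ 2 - (d / 2 - |t|) ^ 2 ≤ v ^ 2) (hhi : v ^ 2 ≤ r ^ 2 - (d / 2 + |t|) ^ 2) :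
    (t, v) ∈ biannulus r q d := by
  simp only [biannulus, Set.mem_ofPred_eq]
  rcases abs_cases t with ⟨h, h'⟩ | ⟨h, h'⟩ <;> rw [h] at hlo hhi <;>
    refine ⟨⟨?_, ?_⟩, ?_, ?_⟩ <;> nlinarith

theorem le_volume_biannulus {r q d T : ℝ} (hr : 0 < r) (hd0 : 0 ≤ d) (hdr : d ≤ r)
    (hT0 : 0 ≤ T) (hTr : d / 2 + T ≤ r) (hTd : 2 * d * T ≤ r ^ 2 - q ^ 2)
    (hTq : d ^ 2 / 2 + 2 * T ^ 2 ≤ r ^ 2 + q ^ 2) :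
    ENNReal.ofReal (4 * ((r ^ 2 - q ^ 2) * T - d * T ^ 2) / √(4 * r ^ 2 - d ^ 2)) ≤
      volume (biannulus r q d) := by
  set s := √(4 * r ^ 2 - d ^ 2) with hs
  have hspos : 0 < s := Real.sqrt_pos.2 (by nlinarith)
  set g : ℝ → ℝ := fun t => √(r ^ 2 - (d / 2 + |t|) ^ 2) with hg
  set w : ℝ → ℝ := fun t => (r ^ 2 - q ^ 2) / s - 2 * d / s * |t| with hw
  set f : ℝ → ℝ := fun t => g t - w t with hf
  have hgc : Continuous g := by fun_prop
  have hwc : Continuous w := by fun_prop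
  have hfc : Continuous f := hgc.sub hwc
  have hint : ∀ {h : ℝ → ℝ}, Continuous h → IntegrableOn h (Set.Ioc (-T) T) := fun hh =>
    (hh.integrableOn_Icc).mono_set Set.Ioc_subset_Icc_self
  have key : ∀ t ∈ Set.Ioc (-T) T, 0 ≤ w t ∧ 0 ≤ f t ∧
      q ^ 2 - (d / 2 - |t|) ^ 2 ≤ f t ^ 2 ∧ g t ^ 2 = r ^ 2 - (d / 2 + |t|) ^ 2 := by
    intro t ht
    have htT : |t| ≤ T := abs_le.2 ⟨ht.1.le, ht.2⟩
    have ht0 := abs_nonneg t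
    have ha : 0 ≤ r ^ 2 - (d / 2 + |t|) ^ 2 :=
      sub_nonneg.2 (pow_le_pow_left₀ (by positivity) (by linarith [hTr]) 2)
    have hdt : d * |t| ≤ d * T := mul_le_mul_of_nonneg_left htT hd0
    have hwt : w t = ((r ^ 2 - (d / 2 + |t|) ^ 2) - (q ^ 2 - (d / 2 - |t|) ^ 2)) / s := by
      simp only [hw]
      field_simp
      ring
    have h2s : 2 * √(r ^ 2 - (d / 2 + |t|) ^ 2) ≤ s := by
      rw [hs]
      apply Real.le_sqrt_of_sq_le
      rw [mul_pow, Real.sq_sqrt ha]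
      nlinarith
    have := sqrt_sub_div_bounds (a := r ^ 2 - (d / 2 + |t|) ^ 2)
      (b := q ^ 2 - (d / 2 - |t|) ^ 2) (by nlinarith) (by nlinarith) hspos h2s
    rw [← hwt] at this
    refine ⟨?_, this.1, this.2, Real.sq_sqrt ha⟩
    rw [hwt]
    exact div_nonneg (by nlinarith) hspos.le
  have hup : regionBetween f g (Set.Ioc (-T) T) ⊆ biannulus r q d := by
    rintro ⟨t, v⟩ ⟨ht, hv⟩
    obtain ⟨-, h1, h2, h3⟩ := key t ht
    simp only [Set.mem_Ioo] at hv
    exact mem_biannulus_of_abs hd0 (by nlinarith) (by nlinarith)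
  have hdown : regionBetween (-g) (-f) (Set.Ioc (-T) T) ⊆ biannulus r q d := by
    rintro ⟨t, v⟩ ⟨ht, hv⟩
    obtain ⟨-, h1, h2, h3⟩ := key t ht
    simp only [Set.mem_Ioo, Pi.neg_apply] at hv
    exact mem_biannulus_of_abs hd0 (by nlinarith) (by nlinarith)
  have hdisj : Disjoint (regionBetween f g (Set.Ioc (-T) T))
      (regionBetween (-g) (-f) (Set.Ioc (-T) T)) := by
    rw [Set.disjoint_left]
    rintro ⟨t, v⟩ ⟨ht, hv⟩ ⟨-, hv'⟩
    obtain ⟨-, h1, -⟩ := key t ht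
    simp only [Set.mem_Ioo, Pi.neg_apply] at hv hv'
    linarith [hv.1, hv'.2]
  have hI : ∫ t in Set.Ioc (-T) T, w t
      = 2 * ((r ^ 2 - q ^ 2) * T - d * T ^ 2) / s := by
    rw [integral_sub_mul_abs _ _ _ hT0]
    field_simp
  have hI0 : 0 ≤ ∫ t in Set.Ioc (-T) T, w t :=
    setIntegral_nonneg measurableSet_Ioc fun t ht => (key t ht).1
  have hvup : volume (regionBetween f g (Set.Ioc (-T) T))
      = ENNReal.ofReal (∫ t in Set.Ioc (-T) T, w t) := by
    rw [Measure.volume_eq_prod, volume_regionBetween_eq_integral (hint hfc) (hint hgc)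
      measurableSet_Ioc (fun t ht => by linarith [(key t ht).1, show f t = g t - w t from rfl])]
    congr 2
    ext t
    simp [hf]
  have hvdown : volume (regionBetween (-g) (-f) (Set.Ioc (-T) T))
      = ENNReal.ofReal (∫ t in Set.Ioc (-T) T, w t) := by
    rw [Measure.volume_eq_prod, volume_regionBetween_eq_integral (hint hgc.neg) (hint hfc.neg)
      measurableSet_Ioc (fun t ht => by
        simp only [Pi.neg_apply]
        linarith [(key t ht).1, show f t = g t - w t from rfl])]
    congr 2
    ext t
    simp [hf]
  calc ENNReal.ofReal (4 * ((r ^ 2 - q ^ 2) * T - d * T ^ 2) / s)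
      = ENNReal.ofReal ((∫ t in Set.Ioc (-T) T, w t) + ∫ t in Set.Ioc (-T) T, w t) := by
        rw [hI]
        congr 1
        ring
    _ = volume (regionBetween f g (Set.Ioc (-T) T) ∪
          regionBetween (-g) (-f) (Set.Ioc (-T) T)) := by
        rw [measure_union hdisj (measurableSet_regionBetween hgc.neg.measurable
          hfc.neg.measurable measurableSet_Ioc), hvup, hvdown, ENNReal.ofReal_add hI0 hI0]
    _ ≤ volume (biannulus r q d) := measure_mono (Set.union_subset hup hdown)

theorem exists_norm_eq_one_sub_eq_smul (x y : EuclideanSpace ℝ (Fin 2)) :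
    ∃ e : EuclideanSpace ℝ (Fin 2), ‖e‖ = 1 ∧ y - x = ‖y - x‖ • e := by
  by_cases h : y - x = 0
  · exact ⟨EuclideanSpace.single 0 1, by simp, by simp [h]⟩
  · refine ⟨‖y - x‖⁻¹ • (y - x), norm_smul_inv_norm h, ?_⟩
    rw [smul_smul, mul_inv_cancel₀ (norm_ne_zero_iff.2 h), one_smul]

theorem exists_orthonormalBasis_apply_zero_eq {e : EuclideanSpace ℝ (Fin 2)} (he : ‖e‖ = 1) :
    ∃ b : OrthonormalBasis (Fin 2) ℝ (EuclideanSpace ℝ (Fin 2)), b 0 = e := by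
  have hv : Orthonormal ℝ (({0} : Set (Fin 2)).domRestrict fun _ => e) := by
    refine ⟨fun _ => he, fun i j hij => (hij (Subsingleton.elim i j)).elim⟩
  obtain ⟨b, hb⟩ := hv.exists_orthonormalBasis_extension_of_card_eq (by simp)
  exact ⟨b, hb 0 rfl⟩

theorem volume_biannulus_le_volume_annulus_inter {r ε : ℝ} (hr : 0 ≤ r) (hε1 : ε ≤ 1)
    (x y : EuclideanSpace ℝ (Fin 2)) :
    volume (biannulus r (r * (1 - ε)) ‖y - x‖) ≤ volume (annulus x r ε ∩ annulus y r ε) := by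
  obtain ⟨e, he, hye⟩ := exists_norm_eq_one_sub_eq_smul x y
  obtain ⟨b, rfl⟩ := exists_orthonormalBasis_apply_zero_eq he
  set d := ‖y - x‖
  set m := x + (d / 2) • b 0 with hm
  have hφ := ((volume_preserving_finTwoArrow ℝ).comp (PiLp.volume_preserving_ofLp (Fin 2))).comp
    (b.measurePreserving_repr.comp (measurePreserving_sub_right volume m))
  rw [← hφ.measure_preimage (measurableSet_biannulus _ _ _).nullMeasurableSet]
  refine measure_mono fun z hz => ?_
  have hx : z - x = (z - m) + (d / 2) • b 0 := by rw [hm]; abel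
  have hy : z - y = (z - m) - (d / 2) • b 0 := by
    rw [show y = x + d • b 0 by rw [← hye]; abel, hm]
    module
  have hnorm : ∀ u, ‖u‖ ^ 2 = b.repr u 0 ^ 2 + b.repr u 1 ^ 2 := fun u => by
    rw [← b.repr.norm_map u, EuclideanSpace.norm_sq_eq]
    simp
  have hdx : dist z x ^ 2 = (b.repr (z - m) 0 + d / 2) ^ 2 + b.repr (z - m) 1 ^ 2 := by
    rw [dist_eq_norm, hnorm, hx]
    simp [-map_sub]
  have hdy : dist z y ^ 2 = (b.repr (z - m) 0 - d / 2) ^ 2 + b.repr (z - m) 1 ^ 2 := by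
    rw [dist_eq_norm, hnorm, hy, map_sub b.repr (z - m)]
    simp [-map_sub]
  have hz' : (b.repr (z - m) 0, b.repr (z - m) 1) ∈ biannulus r (r * (1 - ε)) d := hz
  simp only [biannulus, Set.mem_ofPred_eq] at hz'
  rw [← hdx, ← hdy] at hz'
  have hq : 0 ≤ r * (1 - ε) := mul_nonneg hr (by linarith)
  exact ⟨⟨le_of_sq_le_sq hz'.1.1 dist_nonneg, le_of_sq_le_sq hz'.1.2 hr⟩,
    ⟨le_of_sq_le_sq hz'.2.1 dist_nonneg, le_of_sq_le_sq hz'.2.2 hr⟩⟩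

theorem volume_annulus_toReal {r ε : ℝ} (hr : 0 ≤ r) (hε0 : 0 ≤ ε) (hε1 : ε ≤ 1)
    (x : EuclideanSpace ℝ (Fin 2)) :
    (volume (annulus x r ε)).toReal = Real.pi * (r ^ 2 - (r * (1 - ε)) ^ 2) := by
  have hq : 0 ≤ r * (1 - ε) := mul_nonneg hr (by linarith)
  have hset : annulus x r ε = Metric.closedBall x r \ Metric.ball x (r * (1 - ε)) := by
    ext z
    simp [annulus, and_comm]
  have hsub : Metric.ball x (r * (1 - ε)) ⊆ Metric.closedBall x r :=
    Metric.ball_subset_closedBall.trans (Metric.closedBall_subset_closedBall (by nlinarith))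
  rw [hset, measure_sdiff hsub measurableSet_ball.nullMeasurableSet measure_ball_lt_top.ne,
    ENNReal.toReal_sub_of_le (measure_mono hsub) measure_closedBall_lt_top.ne]
  simp only [EuclideanSpace.volume_closedBall_fin_two, EuclideanSpace.volume_ball_fin_two,
    ENNReal.toReal_mul, ENNReal.toReal_pow, ENNReal.toReal_ofReal hr, ENNReal.toReal_ofReal hq,
    ENNReal.toReal_ofReal Real.pi_pos.le]
  ring

theorem mul_sqrt_le_sqrt_three_mul {r d : ℝ} (hd0 : 0 ≤ d) (hdr : d ≤ r) :
    d * √(4 * r ^ 2 - d ^ 2) ≤ √3 * r ^ 2 := by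
  have h : d ^ 2 ≤ r ^ 2 := by nlinarith
  apply le_of_sq_le_sq _ (by positivity)
  rw [mul_pow, mul_pow, Real.sq_sqrt (by nlinarith), Real.sq_sqrt (by norm_num)]
  nlinarith [mul_nonneg (sub_nonneg.2 h) (show 0 ≤ 3 * r ^ 2 - d ^ 2 by nlinarith)]

theorem sqrt_three_mul_sqrt_le {r d : ℝ} (hd0 : 0 ≤ d) (hdr : d ≤ r) :
    √3 * √(4 * r ^ 2 - d ^ 2) ≤ 4 * r - d := by
  have h : d ^ 2 ≤ r ^ 2 := by nlinarith
  apply le_of_sq_le_sq _ (by linarith)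
  rw [mul_pow, Real.sq_sqrt (by norm_num), Real.sq_sqrt (by nlinarith)]
  nlinarith [sq_nonneg (r - d)]

/-- The half-width `T` is chosen as the crossing point of the two boundary circles when they
cross, and as `r / 2` otherwise. -/
theorem exists_halfWidth {r ε d : ℝ} (hr : 0 < r) (hε0 : 0 < ε) (hε1 : ε ≤ 1)
    (hqd : r * (1 - ε) ≤ d) (hdr : d ≤ r) :
    ∃ T, 0 ≤ T ∧ d / 2 + T ≤ r ∧ 2 * d * T ≤ r ^ 2 - (r * (1 - ε)) ^ 2 ∧
      d ^ 2 / 2 + 2 * T ^ 2 ≤ r ^ 2 + (r * (1 - ε)) ^ 2 ∧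
      ε / √3 * (r ^ 2 - (r * (1 - ε)) ^ 2) ≤
        4 * ((r ^ 2 - (r * (1 - ε)) ^ 2) * T - d * T ^ 2) / √(4 * r ^ 2 - d ^ 2) := by
  have hq : 0 ≤ r * (1 - ε) := mul_nonneg hr.le (by linarith)
  have hd0 : 0 ≤ d := hq.trans hqd
  set s := √(4 * r ^ 2 - d ^ 2) with hs
  have hspos : 0 < s := Real.sqrt_pos.2 (by nlinarith)
  have h3 : 0 < √(3 : ℝ) := by positivity
  have hG : r ^ 2 - (r * (1 - ε)) ^ 2 = r ^ 2 * (ε * (2 - ε)) := by ring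
  by_cases hεd : r * ε ≤ d
  · have hdpos : 0 < d := (mul_pos hr hε0).trans_le hεd
    set G := r ^ 2 - (r * (1 - ε)) ^ 2 with hGdef
    have hGr : r ^ 2 * ε ≤ G := by
      rw [hG]
      have : 0 ≤ r ^ 2 * ε * (1 - ε) := 
        mul_nonneg (by positivity) (by linarith)
      nlinarith
    have hG0 : 0 ≤ G := le_trans (by positivity) hGr
    set T := G / (2 * d) with hT
    have hdT : 2 * d * T = G := by rw [hT]; field_simp
    have hT0 : 0 ≤ T := by positivity
    have hTr : d / 2 + T ≤ r := by
      have : d * (d / 2 + T) ≤ d * r := by nlinarith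
      exact le_of_mul_le_mul_left this hdpos
    refine ⟨T, hT0, hTr, hdT.le, by nlinarith, ?_⟩
    have hval : 4 * (G * T - d * T ^ 2) / s = G * G / (d * s) := by
      rw [hT]
      field_simp
      ring
    rw [hval, div_mul_eq_mul_div, div_le_div_iff₀ h3 (by positivity)]
    have hds := mul_sqrt_le_sqrt_three_mul hd0 hdr
    calc ε * G * (d * s) ≤ ε * G * (√3 * r ^ 2) := by gcongr
      _ = G * (r ^ 2 * ε) * √3 := by ring
      _ ≤ G * G * √3 := by gcongr
  · push Not at hεd
    refine ⟨r / 2, by positivity, by linarith, by nlinarith, by nlinarith, ?_⟩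
    rw [div_mul_eq_mul_div, div_le_div_iff₀ h3 hspos, hG]
    have hss := sqrt_three_mul_sqrt_le hd0 hdr
    have hε2 : 0 ≤ ε ^ 2 * (2 - ε) := mul_nonneg (by positivity) (by linarith)
    have hpoly : ε ^ 2 * (2 - ε) * (4 * r - d) ≤ 3 * (2 * (ε * (2 - ε)) * r - d) := by
      have h1 : ε ^ 2 * (2 - ε) ≤ 3 := by nlinarith
      have h2 : ε ^ 2 * (2 - ε) * (4 - ε) ≤ 3 * (2 * (ε * (2 - ε)) - ε) := by
        have : 0 ≤ ε * (1 - ε) * (9 - 5 * ε + ε ^ 2) :=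
          mul_nonneg (mul_nonneg hε0.le (by linarith)) (by nlinarith)
        nlinarith
      nlinarith [mul_nonneg (sub_nonneg.2 h1) (sub_nonneg.2 hεd.le),
        mul_le_mul_of_nonneg_left h2 hr.le]
    have h33 : √(3 : ℝ) * √3 = 3 := Real.mul_self_sqrt (by norm_num)
    refine le_of_mul_le_mul_left ?_ h3
    calc √3 * (ε * (r ^ 2 * (ε * (2 - ε))) * s)
        = r ^ 2 * (ε ^ 2 * (2 - ε) * (√3 * s)) := by ring
      _ ≤ r ^ 2 * (ε ^ 2 * (2 - ε) * (4 * r - d)) := by gcongr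
      _ ≤ r ^ 2 * (3 * (2 * (ε * (2 - ε)) * r - d)) := by gcongr
      _ = √3 * (4 * (r ^ 2 * (ε * (2 - ε)) * (r / 2) - d * (r / 2) ^ 2) * √3) := by
        linear_combination
          (-(r ^ 2 * (2 * (ε * (2 - ε)) * r - d))) * h33

theorem annulus_inter_measure_lower_bound
    (r ε : ℝ) (hr : 0 < r) (hε0 : 0 ≤ ε) (hε1 : ε ≤ 1)
    (x y : EuclideanSpace ℝ (Fin 2))
    (hxy : y - x ∈ annulus 0 r ε) :
    (ε / (Real.pi * Real.sqrt 3)) * (volume (annulus 0 r ε)).toReal ≤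
      (volume (annulus x r ε ∩ annulus y r ε)).toReal := by
  rcases hε0.eq_or_lt with rfl | hεpos
  · simp
  obtain ⟨hqd, hdr⟩ := hxy
  rw [dist_zero_right] at hqd hdr
  obtain ⟨T, hT0, hTr, hTd, hTq, hbound⟩ := exists_halfWidth hr hεpos hε1 hqd hdr
  have hfin : volume (annulus x r ε ∩ annulus y r ε) ≠ ⊤ :=
    ((measure_mono fun z hz => hz.1.2).trans_lt
      (measure_closedBall_lt_top (x := x) (r := r))).ne
  have hle := (le_volume_biannulus hr (norm_nonneg _) hdr hT0 hTr hTd hTq).trans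
    (volume_biannulus_le_volume_annulus_inter hr.le hε1 x y)
  rw [volume_annulus_toReal hr.le hε0 hε1]
  calc ε / (Real.pi * √3) * (Real.pi * (r ^ 2 - (r * (1 - ε)) ^ 2))
      = ε / √3 * (r ^ 2 - (r * (1 - ε)) ^ 2) := by
        have := Real.pi_pos.ne'
        field_simp
    _ ≤ _ := hbound
    _ ≤ _ := (ENNReal.ofReal_le_iff_le_toReal hfin).1 hle
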